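/- Consider a CIP with a fractional solution x* ∈ ℝ_{≥0}^n satisfying Ax* ≥ b, of objective value y* = c^T·x*. Suppose α, β > 1 satisfy β·(1 − g(B, α))^a > 1. Then there exists z ∈ ℤ_+^n with Az ≥ b and c^T·z ≤ y*·α·β. -/

import Mathlib

/-- The function `g(B, α) = (α · e^{−(α−1)})^B`. -/
noncomputable def gBound (B α : ℝ) : ℝ :=
  (α * Real.exp (-(α - 1))) ^ B

open Finset in
/-- one-step independence: the coordinate `j` is independent of functions not depending on it -/
lemma aux_indep {n : ℕ} (q : Fin n → Bool → ℝ) (j : Fin n)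
    (hq1 : q j true + q j false = 1) (F : (Fin n → Bool) → ℝ)
    (hF : ∀ φ v, F (Function.update φ j v) = F φ) :
    ∑ φ : Fin n → Bool, (∏ k, q k (φ k)) * ((if φ j = true then 1 else 0) * F φ)
      = q j true * ∑ φ : Fin n → Bool, (∏ k, q k (φ k)) * F φ := by
  set R : (Fin n → Bool) → ℝ := fun φ => (∏ k ∈ univ.erase j, q k (φ k)) * F φ with hR
  have hw : ∀ φ : Fin n → Bool, ∏ k, q k (φ k) = q j (φ j) * ∏ k ∈ univ.erase j, q k (φ k) :=
    fun φ => (mul_prod_erase univ (fun k => q k (φ k)) (mem_univ j)).symm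
  have hRu : ∀ φ v, R (Function.update φ j v) = R φ := by
    intro φ v
    simp only [hR, hF]
    congr 1
    refine prod_congr rfl fun k hk => ?_
    rw [Function.update_of_ne (ne_of_mem_erase hk)]
  have hinv : Function.Involutive (fun φ : Fin n → Bool => Function.update φ j (!φ j)) := by
    intro φ; simp
  have hflip : ∑ φ : Fin n → Bool, (if φ j = true then 1 else 0) * R φ
      = ∑ φ : Fin n → Bool, (if φ j = true then 0 else 1) * R φ := by
    rw [← Equiv.sum_comp hinv.toPerm]
    refine sum_congr rfl fun φ _ => ?_
    simp only [Function.Involutive.coe_toPerm, hRu, Function.update_self]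
    cases φ j <;> simp
  have h1 : ∑ φ : Fin n → Bool, (∏ k, q k (φ k)) * ((if φ j = true then 1 else 0) * F φ)
      = q j true * ∑ φ : Fin n → Bool, (if φ j = true then 1 else 0) * R φ := by
    rw [mul_sum]
    refine sum_congr rfl fun φ _ => ?_
    rw [hw]
    simp only [hR]
    cases φ j <;> simp; ring
  have h2 : ∑ φ : Fin n → Bool, (∏ k, q k (φ k)) * F φ
      = q j true * (∑ φ : Fin n → Bool, (if φ j = true then 1 else 0) * R φ)
        + q j false * ∑ φ : Fin n → Bool, (if φ j = true then 0 else 1) * R φ := by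
    rw [mul_sum, mul_sum, ← sum_add_distrib]
    refine sum_congr rfl fun φ _ => ?_
    rw [hw]
    simp only [hR]
    cases φ j <;> simp <;> ring
  rw [h1, h2, ← hflip, ← add_mul, hq1, one_mul]

/-- expectation of a product -/
lemma aux_prod {n : ℕ} (q h : Fin n → Bool → ℝ) :
    ∑ φ : Fin n → Bool, (∏ k, q k (φ k)) * ∏ k, h k (φ k)
      = ∏ k, (q k true * h k true + q k false * h k false) := by
  have := Finset.prod_univ_sum (fun _ : Fin n => (Finset.univ : Finset Bool))
    (fun k v => q k v * h k v)
  simp only [Fintype.piFinset_univ] at this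
  simp only [Finset.prod_mul_distrib] at this
  rw [← this]
  simp

/-- FKG for the product measure -/
lemma aux_fkg {n : ℕ} (q : Fin n → Bool → ℝ) (hq0 : ∀ j v, 0 ≤ q j v)
    (hq1 : ∀ j, q j true + q j false = 1) (f g : (Fin n → Bool) → ℝ)
    (hf0 : 0 ≤ f) (hg0 : 0 ≤ g) (hf : Monotone f) (hg : Monotone g) :
    (∑ φ : Fin n → Bool, (∏ k, q k (φ k)) * f φ) * (∑ φ : Fin n → Bool, (∏ k, q k (φ k)) * g φ)
      ≤ ∑ φ : Fin n → Bool, (∏ k, q k (φ k)) * (f φ * g φ) := by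
  have h1 : ∑ φ : Fin n → Bool, (∏ k, q k (φ k)) = 1 := by
    have := aux_prod q (fun _ _ => 1)
    simpa [hq1] using this
  have := fkg (μ := fun φ : Fin n → Bool => ∏ k, q k (φ k)) (f := f) (g := g)
    (fun φ => Finset.prod_nonneg fun k _ => hq0 k _) hf0 hg0 hf hg (by
      intro φ ψ
      simp only [← Finset.prod_mul_distrib]
      refine le_of_eq (Finset.prod_congr rfl fun k _ => ?_)
      simp only [Pi.inf_apply, Pi.sup_apply]
      cases φ k <;> cases ψ k <;> simp [mul_comm])
  rwa [h1, one_mul] at this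

lemma aux_base {α : ℝ} (hα : 1 < α) : 
    0 < α * Real.exp (-(α - 1)) ∧ α * Real.exp (-(α - 1)) < 1 := by
  refine ⟨by positivity, ?_⟩
  have h := Real.add_one_lt_exp (x := α - 1) (by linarith)
  rw [Real.exp_neg, ← div_eq_mul_inv, div_lt_one (Real.exp_pos _)]
  linarith

/-- one-coordinate moment bound -/
lemma aux_mgf {α A p : ℝ} (hα : 1 < α) (hA : A ∈ Set.Icc (0:ℝ) 1) (hp0 : 0 ≤ p) (f : ℕ) :
    p * Real.exp (-(Real.log α) * (A * (f + 1))) + (1 - p) * Real.exp (-(Real.log α) * (A * f))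
      ≤ Real.exp (-(1 - 1/α) * (A * (f + p))) := by
  have hα0 : 0 < α := by linarith
  have hlog : 1 - 1/α ≤ Real.log α := by
    have := Real.one_sub_inv_le_log_of_pos hα0
    simpa using this
  have hE : Real.exp (-(Real.log α) * A) ≤ 1 - A * (1 - 1/α) := by
    have h := convexOn_exp.2 (Set.mem_univ (0:ℝ)) (Set.mem_univ (-Real.log α))
      (by linarith [hA.2] : 0 ≤ 1 - A) hA.1 (by ring)
    simp only [smul_eq_mul, mul_zero, zero_add, Real.exp_zero, Real.exp_neg, Real.exp_log hα0] at h
    rw [mul_comm]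
    calc _ ≤ _ := h
      _ = _ := by rw [one_div]; ring
  have h1 : Real.exp (-(Real.log α) * (A * (f + 1)))
      = Real.exp (-(Real.log α) * A) * Real.exp (-(Real.log α) * (A * f)) := by
    rw [← Real.exp_add]; congr 1; ring
  have h2 : Real.exp (-(1 - 1/α) * (A * (f + p)))
      = Real.exp (-(p * (A * (1 - 1/α)))) * Real.exp (-(1 - 1/α) * (A * f)) := by
    rw [← Real.exp_add]; congr 1; ring
  have h3 : p * Real.exp (-(Real.log α) * A) + (1 - p) ≤ Real.exp (-(p * (A * (1 - 1/α)))) := by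
    have := Real.add_one_le_exp (-(p * (A * (1 - 1/α))))
    nlinarith [mul_le_mul_of_nonneg_left hE hp0]
  have h4 : Real.exp (-(Real.log α) * (A * f)) ≤ Real.exp (-(1 - 1/α) * (A * f)) := by
    apply Real.exp_le_exp.2
    have : 0 ≤ A * (f:ℝ) := mul_nonneg hA.1 (Nat.cast_nonneg _)
    nlinarith
  rw [h1, h2]
  calc _ = (p * Real.exp (-(Real.log α) * A) + (1 - p)) * Real.exp (-(Real.log α) * (A * f)) := by
        ring
    _ ≤ _ := mul_le_mul h3 h4 (Real.exp_pos _).le (Real.exp_pos _).le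

/-- Chernoff lower tail -/
lemma aux_chernoff {n : ℕ} {α : ℝ} (hα : 1 < α) (A : Fin n → ℝ)
    (hA : ∀ j, A j ∈ Set.Icc (0:ℝ) 1) (p : Fin n → ℝ) (hp0 : ∀ j, 0 ≤ p j) (hp1 : ∀ j, p j ≤ 1)
    (f : Fin n → ℕ) (b : ℝ) (hb : α * b ≤ ∑ j, A j * (f j + p j)) :
    1 - (α * Real.exp (-(α - 1))) ^ b ≤
    ∑ φ : Fin n → Bool, (∏ k, (if φ k = true then p k else 1 - p k)) *
      (if b ≤ ∑ j, A j * ((f j + (if φ j = true then 1 else 0) : ℕ) : ℝ) then 1 else 0) := by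
  have hα0 : 0 < α := by linarith
  set q : Fin n → Bool → ℝ := fun k v => if v = true then p k else 1 - p k with hq
  set S : (Fin n → Bool) → ℝ :=
    fun φ => ∑ j, A j * ((f j + (if φ j = true then 1 else 0) : ℕ) : ℝ) with hS
  have hq0 : ∀ k v, 0 ≤ q k v := by
    intro k v; cases v <;> simp [hq, hp0, hp1]
  have hsum : ∑ φ : Fin n → Bool, (∏ k, q k (φ k)) = 1 := by
    have := aux_prod q (fun _ _ => 1)
    simpa [hq] using this
  have key : ∑ φ : Fin n → Bool, (∏ k, q k (φ k)) *
      ∏ k, Real.exp (-(Real.log α) * (A k * ((f k + (if φ k = true then 1 else 0) : ℕ) : ℝ)))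
      ≤ Real.exp (-(1 - 1/α) * ∑ j, A j * (f j + p j)) := by
    rw [aux_prod q (fun k v => Real.exp (-(Real.log α) *
      (A k * ((f k + (if v = true then 1 else 0) : ℕ) : ℝ)))), Finset.mul_sum, Real.exp_sum]
    refine Finset.prod_le_prod (fun k _ => ?_) (fun k _ => ?_)
    · have := hq0 k true
      have := hq0 k false
      positivity
    · simpa [hq] using aux_mgf hα (hA k) (hp0 k) (f k)
  have hpt : ∀ φ : Fin n → Bool, 1 - (if b ≤ S φ then (1:ℝ) else 0) ≤
      Real.exp (Real.log α * b) * ∏ k, Real.exp (-(Real.log α) *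
        (A k * ((f k + (if φ k = true then 1 else 0) : ℕ) : ℝ))) := by
    intro φ
    rw [← Real.exp_sum, ← Finset.mul_sum, ← Real.exp_add]
    split_ifs with h
    · simpa using (Real.exp_pos _).le
    · have hl := Real.log_pos hα
      have : S φ < b := not_le.1 h
      rw [sub_zero]
      apply Real.one_le_exp
      change 0 ≤ Real.log α * b + -Real.log α * S φ
      nlinarith
  have hfin : Real.exp (Real.log α * b) * Real.exp (-(1 - 1/α) * ∑ j, A j * (f j + p j))
      ≤ (α * Real.exp (-(α - 1))) ^ b := by
    rw [Real.rpow_def_of_pos (aux_base hα).1, Real.log_mul hα0.ne' (Real.exp_pos _).ne',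
      Real.log_exp, ← Real.exp_add]
    apply Real.exp_le_exp.2
    have h1 : 0 ≤ 1 - 1/α := by
      rw [sub_nonneg, div_le_one hα0]; linarith
    have h2 := mul_le_mul_of_nonneg_left hb h1
    have h3 : (1 - 1/α) * (α * b) = (α - 1) * b := by field_simp
    nlinarith
  have h1 : ∑ φ : Fin n → Bool, (∏ k, q k (φ k)) * (1 - (if b ≤ S φ then (1:ℝ) else 0))
      ≤ (α * Real.exp (-(α - 1))) ^ b := by
    refine le_trans ?_ hfin
    refine le_trans ?_ (mul_le_mul_of_nonneg_left key (Real.exp_pos _).le)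
    rw [Finset.mul_sum]
    refine Finset.sum_le_sum fun φ _ => ?_
    calc _ ≤ _ := mul_le_mul_of_nonneg_left (hpt φ) (Finset.prod_nonneg fun k _ => hq0 k _)
      _ = _ := by ring
  simp only [mul_sub, Finset.sum_sub_distrib, mul_one, hsum] at h1
  linarith

/-- Consider a CIP (`A ∈ [0,1]^{m×n}`, `b ∈ [1,∞)^m`, `c ∈ [0,1]^n` with
`max_j c_j = 1`, `B = min_i b_i`, `a` the maximum number of nonzero entries in a column of
`A`) with a fractional solution `x* ≥ 0`, `Ax* ≥ b`, of value `y* = c^T·x*`. If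
`α, β > 1` satisfy `β·(1 − g(B,α))^a > 1`, then there exists `z ∈ ℤ_+^n` with `Az ≥ b` and
`c^T·z ≤ y*·α·β`. -/
theorem cip_integrality_gap
    (m n : ℕ) (hm : 0 < m)
    (A : Fin m → Fin n → ℝ) (hA : ∀ i j, A i j ∈ Set.Icc (0 : ℝ) 1)
    (b : Fin m → ℝ) (hb : ∀ i, 1 ≤ b i)
    (c : Fin n → ℝ) (hc : ∀ j, c j ∈ Set.Icc (0 : ℝ) 1) (hcmax : ∃ j, c j = 1)
    (x : Fin n → ℝ) (hx : ∀ j, 0 ≤ x j)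
    (hAx : ∀ i, b i ≤ ∑ j, A i j * x j)
    (ystar : ℝ) (hystar : ystar = ∑ j, c j * x j)
    (B : ℝ) (hB : IsLeast (Set.range b) B)
    (a : ℕ)
    (ha : a = Finset.univ.sup (fun j : Fin n =>
      (Finset.univ.filter (fun i : Fin m => A i j ≠ 0)).card))
    (α β : ℝ) (hα : 1 < α) (hβ : 1 < β)
    (hgap : 1 < β * (1 - gBound B α) ^ a) :
    ∃ z : Fin n → ℕ,
      (∀ i, b i ≤ ∑ j, A i j * (z j : ℝ)) ∧
      (∑ j, c j * (z j : ℝ)) ≤ ystar * α * β := by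
  classical
  have hα0 : 0 < α := by linarith
  set f : Fin n → ℕ := fun j => ⌊α * x j⌋₊ with hf
  set p : Fin n → ℝ := fun j => α * x j - f j with hp
  have hp0 : ∀ j, 0 ≤ p j := fun j => sub_nonneg.2 (Nat.floor_le (mul_nonneg hα0.le (hx j)))
  have hp1 : ∀ j, p j ≤ 1 := fun j => by
    have := Nat.lt_floor_add_one (α * x j)
    simp only [hp, hf]; linarith
  set q : Fin n → Bool → ℝ := fun k v => if v = true then p k else 1 - p k with hq
  have hq0 : ∀ k v, 0 ≤ q k v := by
    intro k v; cases v <;> simp [hq, hp0, hp1]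
  have hq1 : ∀ k, q k true + q k false = 1 := by intro k; simp [hq]
  set z : (Fin n → Bool) → Fin n → ℕ := fun φ j => f j + (if φ j = true then 1 else 0) with hz
  set e : Fin m → (Fin n → Bool) → ℝ :=
    fun i φ => if b i ≤ ∑ j, A i j * (z φ j : ℝ) then 1 else 0 with he
  set g := gBound B α with hg
  have hB1 : 1 ≤ B := by
    obtain ⟨i, hi⟩ := hB.1
    rw [← hi]; exact hb i
  obtain ⟨hb0, hb1⟩ := aux_base hα
  have hg0 : 0 < g := Real.rpow_pos_of_pos hb0 _
  have hg1 : g < 1 := Real.rpow_lt_one hb0.le hb1 (by linarith)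
  set w : (Fin n → Bool) → ℝ := fun φ => ∏ k, q k (φ k) with hw
  have hw0 : ∀ φ, 0 ≤ w φ := fun φ => Finset.prod_nonneg fun k _ => hq0 k _
  have hsum : ∑ φ, w φ = 1 := by
    have := aux_prod q (fun _ _ => 1)
    simpa [hq1] using this
  have he0 : ∀ i, 0 ≤ e i := fun i φ => by
    simp only [he]; split_ifs <;> simp
  have hele : ∀ i φ, e i φ ≤ 1 := fun i φ => by
    simp only [he]; split_ifs <;> simp
  have hemono : ∀ i, Monotone (e i) := by
    intro i φ ψ h
    have hz' : ∑ j, A i j * (z φ j : ℝ) ≤ ∑ j, A i j * (z ψ j : ℝ) := by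
      refine Finset.sum_le_sum fun j _ => mul_le_mul_of_nonneg_left ?_ (hA i j).1
      have := h j
      simp only [hz]
      revert this
      cases φ j <;> cases ψ j <;> simp
    simp only [he]
    split_ifs with h1 h2
    · exact le_rfl
    · exact absurd (h1.trans hz') h2
    · exact zero_le_one
    · exact le_rfl
  have hch : ∀ i, 1 - g ≤ ∑ φ, w φ * e i φ := by
    intro i
    have h := aux_chernoff hα (A i) (hA i) p hp0 hp1 f (b i) (by
      have h1 : ∑ j, A i j * ((f j : ℝ) + p j) = α * ∑ j, A i j * x j := by
        rw [Finset.mul_sum]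
        refine Finset.sum_congr rfl fun j _ => ?_
        simp only [hp]; ring
      rw [h1]
      exact mul_le_mul_of_nonneg_left (hAx i) hα0.le)
    have h2 : (α * Real.exp (-(α - 1))) ^ (b i) ≤ g :=
      Real.rpow_le_rpow_of_exponent_ge hb0 hb1.le (hB.2 ⟨i, rfl⟩)
    refine le_trans ?_ h
    linarith
  set I : Finset (Fin m) → (Fin n → Bool) → ℝ := fun T φ => ∏ i ∈ T, e i φ with hI
  have hI0 : ∀ T, 0 ≤ I T := fun T φ => Finset.prod_nonneg fun i _ => he0 i φ
  have hImono : ∀ T, Monotone (I T) := fun T φ ψ h =>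
    Finset.prod_le_prod (fun i _ => he0 i φ) (fun i _ => hemono i h)
  have hP0 : ∀ T, 0 ≤ ∑ φ, w φ * I T φ := fun T =>
    Finset.sum_nonneg fun φ _ => mul_nonneg (hw0 φ) (hI0 T φ)
  have hins : ∀ (T U : Finset (Fin m)), Disjoint T U →
      (1 - g) ^ U.card * ∑ φ, w φ * I T φ ≤ ∑ φ, w φ * I (T ∪ U) φ := by
    intro T U
    induction U using Finset.induction_on with
    | empty => intro _; simp
    | insert i U hi ih =>
      intro hd
      rw [Finset.disjoint_insert_right] at hd
      have h1 := ih hd.2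
      have h2 := aux_fkg q hq0 hq1 (e i) (I (T ∪ U)) (he0 i) (hI0 _) (hemono i) (hImono _)
      have hni : i ∉ T ∪ U := by simp [hd.1, hi]
      have h3 : ∀ φ, I (T ∪ insert i U) φ = e i φ * I (T ∪ U) φ := by
        intro φ
        simp only [hI, Finset.union_insert, Finset.prod_insert hni]
      simp only [h3]
      refine le_trans ?_ h2
      rw [Finset.card_insert_of_notMem hi, pow_succ', mul_assoc]
      exact mul_le_mul (hch i) h1
        (mul_nonneg (pow_nonneg (by linarith) _) (hP0 T)) (le_trans (by linarith) (hch i))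
  set PE := ∑ φ, w φ * I Finset.univ φ with hPE
  have hPEpos : 0 < PE := by
    have h := hins ∅ Finset.univ (by simp)
    have h' : ∑ φ, w φ * I ∅ φ = 1 := by simp [hI, hsum]
    rw [h', Finset.empty_union, mul_one] at h
    exact lt_of_lt_of_le (pow_pos (by linarith) _) h
  have hcoord : ∀ j, ∑ φ, w φ * ((if φ j = true then 1 else 0) * I Finset.univ φ)
      ≤ p j * (β * PE) := by
    intro j
    set N := Finset.univ.filter (fun i : Fin m => A i j ≠ 0) with hN
    have hNa : N.card ≤ a := by
      rw [ha]
      exact Finset.le_sup (f := fun j : Fin n =>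
        (Finset.univ.filter (fun i : Fin m => A i j ≠ 0)).card) (Finset.mem_univ j)
    have h1 := hins Nᶜ N disjoint_compl_left
    have h1' : Nᶜ ∪ N = Finset.univ := by
      rw [Finset.union_comm]; exact Finset.union_compl N
    rw [h1'] at h1
    have h2 := aux_indep q j (hq1 j) (I Nᶜ) (by
      intro φ v
      refine Finset.prod_congr rfl fun i hi => ?_
      have hi0 : A i j = 0 := by simpa [hN] using hi
      have : ∑ k, A i k * (z (Function.update φ j v) k : ℝ) = ∑ k, A i k * (z φ k : ℝ) := by
        refine Finset.sum_congr rfl fun k _ => ?_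
        by_cases hk : k = j
        · subst hk; simp [hi0]
        · simp only [hz, Function.update_of_ne hk]
      change (if _ ≤ _ then (1:ℝ) else 0) = if _ ≤ _ then (1:ℝ) else 0
      rw [this])
    have h3 : ∑ φ, w φ * ((if φ j = true then 1 else 0) * I Finset.univ φ)
        ≤ ∑ φ, w φ * ((if φ j = true then 1 else 0) * I Nᶜ φ) := by
      refine Finset.sum_le_sum fun φ _ => mul_le_mul_of_nonneg_left
        (mul_le_mul_of_nonneg_left ?_ (by split_ifs <;> simp)) (hw0 φ)
      have h7 : I Nᶜ φ * I N φ = I Finset.univ φ := by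
        simp only [hI]
        rw [← Finset.prod_union disjoint_compl_left, h1']
      rw [← h7]
      exact mul_le_of_le_one_right (hI0 _ φ)
        (Finset.prod_le_one (fun i _ => he0 i φ) (fun i _ => hele i φ))
    have hqj : q j true = p j := by simp [hq]
    rw [hqj] at h2
    refine (h3.trans_eq h2).trans (mul_le_mul_of_nonneg_left ?_ (hp0 j))
    have h4 : (1 - g) ^ a ≤ (1 - g) ^ N.card :=
      pow_le_pow_of_le_one (by linarith) (by linarith) hNa
    have h5 := mul_le_mul_of_nonneg_right h4 (hP0 Nᶜ)
    have h6 := mul_le_mul_of_nonneg_left (h5.trans h1) (by linarith : 0 ≤ β)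
    refine le_trans ?_ h6
    rw [← mul_assoc]
    exact le_mul_of_one_le_left (hP0 Nᶜ) hgap.le
  have hcost : ∑ φ, w φ * I Finset.univ φ * ∑ j, c j * (z φ j : ℝ) ≤ ystar * α * β * PE := by
    have h1 : ∑ φ, w φ * I Finset.univ φ * ∑ j, c j * (z φ j : ℝ)
        = ∑ j, c j * (f j * PE
          + ∑ φ, w φ * ((if φ j = true then 1 else 0) * I Finset.univ φ)) := by
      simp only [hPE, Finset.mul_sum, ← Finset.sum_add_distrib]
      rw [Finset.sum_comm]
      refine Finset.sum_congr rfl fun j _ => Finset.sum_congr rfl fun φ _ => ?_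
      simp only [hz]
      push_cast
      ring
    rw [h1, hystar, Finset.sum_mul, Finset.sum_mul, Finset.sum_mul]
    refine Finset.sum_le_sum fun j _ => ?_
    have h2 : c j * x j * α * β * PE = c j * (f j * (β * PE) + p j * (β * PE)) := by
      simp only [hp]; ring
    rw [h2]
    refine mul_le_mul_of_nonneg_left (add_le_add ?_ (hcoord j)) (hc j).1
    exact mul_le_mul_of_nonneg_left (le_mul_of_one_le_left hPEpos.le hβ.le) (Nat.cast_nonneg _)
  have hex : ∃ φ, 0 < w φ * I Finset.univ φ ∧ ∑ j, c j * (z φ j : ℝ) ≤ ystar * α * β := by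
    by_contra! hcon
    have hnn : ∀ φ, 0 ≤ w φ * I Finset.univ φ := fun φ => mul_nonneg (hw0 φ) (hI0 _ φ)
    obtain ⟨φ₀, -, hφ₀⟩ : ∃ φ ∈ Finset.univ, 0 < w φ * I Finset.univ φ :=
      (Finset.sum_pos_iff_of_nonneg fun φ _ => hnn φ).1 hPEpos
    have : ystar * α * β * PE < ∑ φ, w φ * I Finset.univ φ * ∑ j, c j * (z φ j : ℝ) := by
      rw [mul_comm, hPE, Finset.sum_mul]
      refine Finset.sum_lt_sum (fun φ _ => ?_) ⟨φ₀, Finset.mem_univ _,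
        mul_lt_mul_of_pos_left (hcon φ₀ hφ₀) hφ₀⟩
      rcases (hnn φ).eq_or_lt with h | h
      · rw [← h]; simp
      · exact (mul_lt_mul_of_pos_left (hcon φ h) h).le
    linarith
  obtain ⟨φ, hφ, hle⟩ := hex
  refine ⟨z φ, fun i => ?_, hle⟩
  by_contra hi
  have : I Finset.univ φ = 0 := Finset.prod_eq_zero (Finset.mem_univ i) (by simp only [he, if_neg hi])
  rw [this] at hφ
  simp at hφ
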